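/- Fix l ∈ ℝ^n and η > 0, and assume 0 < ∫_0^∞ y^{−n−2} f(l/y) dy < ∞ and ∫_0^∞ y^{−n−1} f(l/y) dy < ∞. For each k ≥ 1 let π_k(σ) = (1/(kσ)) φ((log σ)/k) for σ > 0 (the density of σ with log σ ∼ N(0, k²)), and define δ*_k(l, η^k) = (∫_0^∞ y^{−n} f(l/y) π_k(η^k y) dy)/(∫_0^∞ y^{−n−1} f(l/y) π_k(η^k y) dy). Then lim_{k→∞} δ*_k(l, η^k) = σ̂₀(l) = (∫_0^∞ σ^{−n−1} f(l/σ) dσ)/(∫_0^∞ σ^{−n−2} f(l/σ) dσ). -/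

import Mathlib

open MeasureTheory ENNReal Filter Topology

/-- The standard normal density. -/
noncomputable def stdNormal (t : ℝ) : ℝ :=
  Real.exp (-(t ^ 2) / 2) / Real.sqrt (2 * Real.pi)

/-- The density of `σ` when `log σ ∼ N(0, k²)`. -/
noncomputable def logGaussPrior (k σ : ℝ) : ℝ := stdNormal (Real.log σ / k) / (k * σ)

lemma continuous_stdNormal : Continuous stdNormal := by
  unfold stdNormal
  fun_prop

lemma stdNormal_pos (t : ℝ) : 0 < stdNormal t := by
  unfold stdNormal
  positivity

lemma stdNormal_le_inv_sqrt (t : ℝ) : stdNormal t ≤ 1 / Real.sqrt (2 * Real.pi) := by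
  unfold stdNormal
  gcongr
  exact Real.exp_le_one_iff.2 (by nlinarith [sq_nonneg t])

/-- Weighting an integrable function by the normal density of `log (η ^ k * y) / k` and letting
`k → ∞` multiplies its integral by the constant `stdNormal (log η)`. -/
lemma tendsto_integral_mul_stdNormal_log {g : ℝ → ℝ} (hg : IntegrableOn g (Set.Ioi 0))
    {η : ℝ} (hη : 0 < η) :
    Tendsto (fun k : ℝ => ∫ y in Set.Ioi (0 : ℝ), g y * stdNormal (Real.log (η ^ k * y) / k))
      atTop (𝓝 ((∫ y in Set.Ioi (0 : ℝ), g y) * stdNormal (Real.log η))) := by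
  rw [← integral_mul_const]
  refine tendsto_integral_filter_of_dominated_convergence
    (fun y => ‖g y‖ * (1 / Real.sqrt (2 * Real.pi))) ?_ ?_ (hg.norm.mul_const _) ?_
  · refine Eventually.of_forall fun k => hg.aestronglyMeasurable.mul ?_
    exact (continuous_stdNormal.measurable.comp
      ((Real.measurable_log.comp (measurable_const.mul measurable_id)).div_const k)
      ).aestronglyMeasurable
  · refine Eventually.of_forall fun k => Eventually.of_forall fun y => ?_
    rw [norm_mul, Real.norm_of_nonneg (stdNormal_pos _).le]
    gcongr
    exact stdNormal_le_inv_sqrt _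
  · filter_upwards [ae_restrict_mem measurableSet_Ioi] with y hy
    refine ((continuous_stdNormal.tendsto _).comp ?_).const_mul _
    have h : Tendsto (fun k : ℝ => Real.log η + Real.log y / k) atTop (𝓝 (Real.log η)) := by
      simpa using (tendsto_const_nhds (x := Real.log η)).add
        (tendsto_const_nhds.div_atTop tendsto_id : Tendsto (fun k : ℝ => Real.log y / k) _ _)
    refine h.congr' ?_
    filter_upwards [eventually_gt_atTop 0] with k hk
    rw [Real.log_mul (Real.rpow_pos_of_pos hη k).ne' (ne_of_gt hy), Real.log_rpow hη]
    field_simp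

/-- The factor `1 / (k * η ^ k * y)` of the prior lowers the exponent of `y` by one. -/
lemma integral_zpow_mul_logGaussPrior (m : ℤ) (g : ℝ → ℝ) (k η : ℝ) :
    ∫ y in Set.Ioi (0 : ℝ), y ^ m * g y * logGaussPrior k (η ^ k * y) =
      (k * η ^ k)⁻¹ * ∫ y in Set.Ioi (0 : ℝ),
        y ^ (m - 1) * g y * stdNormal (Real.log (η ^ k * y) / k) := by
  rw [← integral_const_mul]
  refine setIntegral_congr_fun measurableSet_Ioi fun y hy => ?_
  simp only [logGaussPrior]
  rw [zpow_sub_one₀ (ne_of_gt hy), ← mul_assoc k, div_eq_mul_inv, mul_inv (k * η ^ k)]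
  ring

/-- The proxy Bayes estimators `δ*_k(l, η^k)` converge to the Pitman scale estimator
`σ̂₀(l)` as `k → ∞`. -/
theorem proxy_bayes_tendsto_pitman_scale
    (n : ℕ) (f : (Fin n → ℝ) → ℝ) (hfm : Measurable f) (hf0 : ∀ x, 0 ≤ f x)
    (hf1 : ∫ x, f x = 1)
    (l : Fin n → ℝ) (η : ℝ) (hη : 0 < η)
    (h1 : IntegrableOn (fun y : ℝ => y ^ (-(n : ℤ) - 2) * f (fun i => l i / y)) (Set.Ioi 0))
    (h2 : 0 < ∫ y in Set.Ioi (0 : ℝ), y ^ (-(n : ℤ) - 2) * f (fun i => l i / y))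
    (h3 : IntegrableOn (fun y : ℝ => y ^ (-(n : ℤ) - 1) * f (fun i => l i / y)) (Set.Ioi 0)) :
    Tendsto (fun k : ℝ =>
        (∫ y in Set.Ioi (0 : ℝ),
            y ^ (-(n : ℤ)) * f (fun i => l i / y) * logGaussPrior k (η ^ k * y)) /
        (∫ y in Set.Ioi (0 : ℝ),
            y ^ (-(n : ℤ) - 1) * f (fun i => l i / y) * logGaussPrior k (η ^ k * y)))
      atTop
      (𝓝 ((∫ σ in Set.Ioi (0 : ℝ), σ ^ (-(n : ℤ) - 1) * f (fun i => l i / σ)) /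
        (∫ σ in Set.Ioi (0 : ℝ), σ ^ (-(n : ℤ) - 2) * f (fun i => l i / σ)))) := by
  have hnum := tendsto_integral_mul_stdNormal_log h3 hη
  have hden := tendsto_integral_mul_stdNormal_log h1 hη
  have hφ := (stdNormal_pos (Real.log η)).ne'
  have hlim := hnum.div hden (mul_ne_zero h2.ne' hφ)
  rw [mul_div_mul_right _ _ hφ] at hlim
  refine hlim.congr' ?_
  filter_upwards [eventually_gt_atTop 0] with k hk
  have hc : (k * η ^ k)⁻¹ ≠ 0 := inv_ne_zero (mul_pos hk (Real.rpow_pos_of_pos hη k)).ne'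
  have hexp : -(n : ℤ) - 1 - 1 = -(n : ℤ) - 2 := by ring
  rw [integral_zpow_mul_logGaussPrior _ (fun y => f (fun i => l i / y)),
    integral_zpow_mul_logGaussPrior _ (fun y => f (fun i => l i / y)),
    mul_div_mul_left _ _ hc, hexp]
  rfl
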